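/- arXiv:2006.14870 — 2 statements merged into one kernel-verified Lean document; each statement's English description precedes it below -/
import Mathlib

section
/- Let k be a positive integer. For x ∈ {0,1}^{2k}, let z(x) ∈ {0,1}^{4k} be the doubled string x₁ x̄₁ x₂ x̄₂ ⋯ x_{2k} x̄_{2k}, where x̄_i = 1 − x_i; note |z(x)| = 2k for every x. Then for every v : {1,…,k} → {1,2} (a choice of one position in each of the k consecutive blocks of size 2 of {1,…,2k}) and every w ∈ {0,1}^k, there exists y ∈ {0,1}^{4k} with |y| = k such that for all x ∈ {0,1}^{2k}, the number of indices i ∈ {1,…,k} with x_{2(i−1)+v(i)} ⊕ w_i = 1 equals |z(x) ∩ y|. -/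
/-- Hamming weight of a bit string. -/
def wt {m : ℕ} (x : Fin m → Bool) : ℕ :=
  (Finset.univ.filter fun i => x i = true).card

/-- Number of indices where both bit strings are one. -/
def inter {m : ℕ} (x y : Fin m → Bool) : ℕ :=
  (Finset.univ.filter fun i => x i = true ∧ y i = true).card

/-- The doubled string `z(x) = x₁ x̄₁ x₂ x̄₂ ⋯ x_{2k} x̄_{2k} ∈ {0,1}^{4k}`
associated to `x ∈ {0,1}^{2k}`. -/
def doubled (k : ℕ) (x : Fin (2 * k) → Bool) : Fin (4 * k) → Bool :=
  fun i =>
    if i.val % 2 = 0 then x ⟨i.val / 2, by omega⟩ else ! x ⟨i.val / 2, by omega⟩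

/-- Every column `(V, w)` of the `(4k, k, ·)`-pattern matrix restricted to doubled
strings is realized as an intersection with a weight-`k` string: `|z(x)| = 2k` for
all `x`, and for every `v : [k] → {1,2}` and `w ∈ {0,1}^k` there is
`y ∈ {0,1}^{4k}` with `|y| = k` such that for all `x ∈ {0,1}^{2k}`, the number of
`i` with `x_{2(i−1)+v(i)} ⊕ w_i = 1` equals `|z(x) ∩ y|`. -/
theorem stmt4 (k : ℕ) (hk : 0 < k) :
    (∀ x : Fin (2 * k) → Bool, wt (doubled k x) = 2 * k) ∧
    ∀ v : Fin k → Fin 2, ∀ w : Fin k → Bool,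
      ∃ y : Fin (4 * k) → Bool, wt y = k ∧
        ∀ x : Fin (2 * k) → Bool,
          (Finset.univ.filter fun i : Fin k =>
            x ⟨2 * i.val + (v i).val, by omega⟩ ≠ w i).card =
          inter (doubled k x) y := by
  constructor
  · intro x
    unfold wt
    conv_rhs => rw [← Fintype.card_fin (2 * k), ← Finset.card_univ]
    symm
    refine Finset.card_bij
      (fun (j : Fin (2 * k)) _ => (⟨2 * j.val + (if x j then 0 else 1), by split <;> omega⟩ : Fin (4 * k)))
      ?_ ?_ ?_
    · intro j _
      cases h : x j
      · have h1 : (2 * j.val + 1) / 2 = j.val := by omega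
        have h2 : (2 * j.val + 1) % 2 = 1 := by omega
        simp [doubled, h, h1, h2]
      · simp [doubled, h]
    · intro a _ b _ hab
      simp only [Fin.mk.injEq] at hab
      apply Fin.ext
      split at hab <;> split at hab <;> omega
    · intro b hb
      refine ⟨⟨b.val / 2, by omega⟩, Finset.mem_univ _, ?_⟩
      replace hb := (Finset.mem_filter.1 hb).2
      unfold doubled at hb
      apply Fin.ext
      simp only
      split at hb
      · rw [if_pos hb]; omega
      · simp only [Bool.not_eq_true'] at hb
        rw [hb]
        simp only [Bool.false_eq_true, if_false]; omega
  · intro v w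
    have key : ∀ i : Fin k, 4 * i.val + 2 * (v i).val + (if w i then 1 else 0) < 4 * k := by
      intro i
      split <;> omega
    have inj : ∀ a b : Fin k, 4 * a.val + 2 * (v a).val + (if w a then 1 else 0)
        = 4 * b.val + 2 * (v b).val + (if w b then 1 else 0) → a = b := by
      intro a b hab
      apply Fin.ext
      split at hab <;> split at hab <;> omega
    let p : Fin k → Fin (4 * k) := fun i => ⟨_, key i⟩
    have pinj : Function.Injective p := fun a b h => inj a b (congrArg Fin.val h)
    have hd : ∀ (x : Fin (2 * k) → Bool) (i : Fin k), doubled k x (p i) = true ↔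
        x ⟨2 * i.val + (v i).val, by omega⟩ ≠ w i := by
      intro x i
      cases h : w i
      · have h1 : (4 * i.val + 2 * (v i).val) / 2 = 2 * i.val + (v i).val := by omega
        have h2 : (4 * i.val + 2 * (v i).val) % 2 = 0 := by omega
        simp [doubled, p, h, h1, h2]
      · have h1 : (4 * i.val + 2 * (v i).val + 1) / 2 = 2 * i.val + (v i).val := by omega
        have h2 : (4 * i.val + 2 * (v i).val + 1) % 2 = 1 := by omega
        simp [doubled, p, h, h1, h2]
    refine ⟨fun j => decide (∃ i, p i = j), ?_, ?_⟩
    · unfold wt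
      conv_rhs => rw [← Fintype.card_fin k, ← Finset.card_univ,
        ← Finset.card_image_of_injective _ pinj]
      congr 1
      ext j
      simp
    · intro x
      unfold inter
      rw [← Finset.card_image_of_injective _ pinj]
      congr 1
      ext j
      simp only [Finset.mem_image, Finset.mem_filter, Finset.mem_univ, true_and, decide_eq_true_eq]
      constructor
      · rintro ⟨i, hi, rfl⟩
        exact ⟨(hd x i).2 hi, i, rfl⟩
      · rintro ⟨h, i, rfl⟩
        exact ⟨i, (hd x i).1 h, rfl⟩
end

section
/- Let n be a positive integer, D ⊆ {0,1}^n, f : D → ℝ a partial function with domain D, ε ≥ 0 a real number, and d ≥ 0 an integer. Then deg_ε(f) > d if and only if there exists ψ : {0,1}^n → ℝ such that ψ̂(S) = 0 for every S ⊆ {1,…,n} with |S| ≤ d, and Σ_{x∈D} f(x)ψ(x) − Σ_{x∉D} |ψ(x)| − ε·Σ_{x∈{0,1}^n} |ψ(x)| > 0. -/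
/-- The Fourier coefficient `ψ̂(S) = 2^{-n} Σ_x ψ(x) (−1)^{Σ_{i∈S} x_i}`. -/
noncomputable def boolFourierCoeff (n : ℕ) (ψ : (Fin n → Bool) → ℝ)
    (S : Finset (Fin n)) : ℝ :=
  (2 ^ n : ℝ)⁻¹ * ∑ x : Fin n → Bool, ψ x * ∏ i ∈ S, (if x i then (-1 : ℝ) else 1)

lemma stmt6_aux_char (n d : ℕ) (ψ : (Fin n → Bool) → ℝ)
    (h : ∀ S : Finset (Fin n), S.card ≤ d → boolFourierCoeff n ψ S = 0)
    (S : Finset (Fin n)) (hS : S.card ≤ d) :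
    ∑ x : Fin n → Bool, ψ x * ∏ i ∈ S, (if x i then (-1 : ℝ) else 1) = 0 := by
  have := h S hS
  unfold boolFourierCoeff at this
  rcases mul_eq_zero.1 this with h1 | h1
  · exact absurd h1 (by positivity)
  · exact h1

lemma stmt6_aux_mono (n : ℕ) (m : Fin n →₀ ℕ) (x : Fin n → Bool) :
    (∏ i ∈ m.support, (if x i then (1 : ℝ) else 0) ^ m i) =
      ∑ T ∈ m.support.powerset, ((∏ i ∈ T, (-1/2 : ℝ)) * ∏ i ∈ m.support \ T, (1/2 : ℝ)) *
        ∏ i ∈ T, (if x i then (-1 : ℝ) else 1) := by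
  have : (∏ i ∈ m.support, (if x i then (1 : ℝ) else 0) ^ m i) =
      ∏ i ∈ m.support, ((-1/2 : ℝ) * (if x i then (-1 : ℝ) else 1) + 1/2) := by
    apply Finset.prod_congr rfl
    intro i hi
    have hi' : m i ≠ 0 := by simpa using hi
    cases x i <;> norm_num [hi']
  rw [this, Finset.prod_add]
  · apply Finset.sum_congr rfl
    intro T _
    rw [Finset.prod_mul_distrib]
    ring

lemma stmt6_aux_orth (n d : ℕ) (ψ : (Fin n → Bool) → ℝ)
    (h : ∀ S : Finset (Fin n), S.card ≤ d → boolFourierCoeff n ψ S = 0)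
    (π : MvPolynomial (Fin n) ℝ) (hπ : π.totalDegree ≤ d) :
    ∑ x : Fin n → Bool, ψ x * MvPolynomial.eval (fun i => if x i then (1 : ℝ) else 0) π = 0 := by
  simp_rw [MvPolynomial.eval_eq, Finset.mul_sum]
  rw [Finset.sum_comm]
  apply Finset.sum_eq_zero
  intro m hm
  have hdeg : m.support.card ≤ d := by
    refine le_trans ?_ ((MvPolynomial.le_totalDegree hm).trans hπ)
    rw [Finsupp.sum, Finset.card_eq_sum_ones]
    apply Finset.sum_le_sum
    intro i hi
    have hi' : m i ≠ 0 := by simpa using hi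
    omega
  simp_rw [stmt6_aux_mono, Finset.mul_sum]
  rw [Finset.sum_comm]
  apply Finset.sum_eq_zero
  intro T hT
  have hT' := (Finset.card_le_card (Finset.mem_powerset.1 hT)).trans hdeg
  have := stmt6_aux_char n d ψ h T hT'
  calc _ = (MvPolynomial.coeff m π * ((∏ i ∈ T, (-1/2 : ℝ)) * ∏ i ∈ m.support \ T, (1/2 : ℝ))) *
      ∑ x : Fin n → Bool, ψ x * ∏ i ∈ T, (if x i then (-1 : ℝ) else 1) := by
        rw [Finset.mul_sum]
        apply Finset.sum_congr rfl
        intro x _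
        ring
    _ = 0 := by rw [this, mul_zero]

/-- Evaluation of a polynomial on all Boolean points, as a linear map. -/
noncomputable def stmt6EvalMap (n : ℕ) : MvPolynomial (Fin n) ℝ →ₗ[ℝ] ((Fin n → Bool) → ℝ) :=
  LinearMap.pi fun x =>
    (MvPolynomial.aeval (R := ℝ) (fun i => if x i then (1 : ℝ) else 0)).toLinearMap

lemma stmt6EvalMap_apply (n : ℕ) (p : MvPolynomial (Fin n) ℝ) (x : Fin n → Bool) :
    stmt6EvalMap n p x = MvPolynomial.eval (fun i => if x i then (1 : ℝ) else 0) p := by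
  simp [stmt6EvalMap, MvPolynomial.aeval_eq_eval]

lemma stmt6_aux_charpoly (n : ℕ) (S : Finset (Fin n)) :
    (∏ i ∈ S, (1 - MvPolynomial.C 2 * MvPolynomial.X i) : MvPolynomial (Fin n) ℝ).totalDegree
      ≤ S.card := by
  refine (MvPolynomial.totalDegree_finsetProd _ _).trans ?_
  rw [Finset.card_eq_sum_ones]
  apply Finset.sum_le_sum
  intro i _
  refine (MvPolynomial.totalDegree_sub _ _).trans ?_
  refine max_le (by simp) ((MvPolynomial.totalDegree_mul _ _).trans ?_)
  simp

theorem stmt6 (n : ℕ) (hn : 0 < n) (D : Finset (Fin n → Bool))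
    (f : (Fin n → Bool) → ℝ) (ε : ℝ) (hε : 0 ≤ ε) (d : ℕ) :
    (¬ ∃ π : MvPolynomial (Fin n) ℝ, π.totalDegree ≤ d ∧
        (∀ x ∈ D,
          |f x - MvPolynomial.eval (fun i => if x i then (1 : ℝ) else 0) π| ≤ ε) ∧
        (∀ x ∉ D,
          |MvPolynomial.eval (fun i => if x i then (1 : ℝ) else 0) π| ≤ 1 + ε)) ↔
      ∃ ψ : (Fin n → Bool) → ℝ,
        (∀ S : Finset (Fin n), S.card ≤ d → boolFourierCoeff n ψ S = 0) ∧
        (∑ x ∈ D, f x * ψ x) - (∑ x ∈ Dᶜ, |ψ x|) -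
            ε * ∑ x : Fin n → Bool, |ψ x| > 0 := by
  classical
  constructor
  · intro hno
    let a : (Fin n → Bool) → ℝ := fun x => if x ∈ D then f x - ε else -(1 + ε)
    let b : (Fin n → Bool) → ℝ := fun x => if x ∈ D then f x + ε else 1 + ε
    let V : Submodule ℝ ((Fin n → Bool) → ℝ) :=
      (MvPolynomial.restrictTotalDegree (Fin n) ℝ d).map (stmt6EvalMap n)
    have hdisj : Disjoint (Set.Icc a b) (V : Set ((Fin n → Bool) → ℝ)) := by
      rw [Set.disjoint_left]
      rintro g hg ⟨p, hp, rfl⟩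
      apply hno
      refine ⟨p, (MvPolynomial.mem_restrictTotalDegree _ _ _).1 hp, ?_, ?_⟩
      · intro x hx
        have h1 := hg.1 x
        have h2 := hg.2 x
        simp only [a, b, hx, if_true, stmt6EvalMap_apply] at h1 h2
        rw [abs_le]; constructor <;> linarith
      · intro x hx
        have h1 := hg.1 x
        have h2 := hg.2 x
        simp only [a, b, hx, if_false, stmt6EvalMap_apply] at h1 h2
        rw [abs_le]; constructor <;> linarith
    obtain ⟨F, u, v, hFu, huv, hFv⟩ := geometric_hahn_banach_compact_closed
      (convex_Icc a b) isCompact_Icc V.convex V.closed_of_finiteDimensional hdisj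
    have hv : v < 0 := by simpa using hFv 0 V.zero_mem
    have hFV : ∀ g ∈ V, F g = 0 := by
      intro g hg
      by_contra hne
      have := hFv ((v / F g) • g) (V.smul_mem _ hg)
      rw [map_smul, smul_eq_mul, div_mul_cancel₀ _ hne] at this
      exact lt_irrefl _ this
    let ψ : (Fin n → Bool) → ℝ := fun x => - F (Pi.single x 1)
    have hF : ∀ g, F g = - ∑ x, ψ x * g x := by
      intro g
      conv_lhs => rw [← Finset.univ_sum_single g]
      rw [map_sum, ← Finset.sum_neg_distrib]
      apply Finset.sum_congr rfl
      intro x _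
      have : (Pi.single x (g x) : (Fin n → Bool) → ℝ) = g x • Pi.single x 1 := by
        rw [← Pi.single_smul]; simp
      rw [this, map_smul]
      simp [ψ, mul_comm]
    refine ⟨ψ, ?_, ?_⟩
    · intro S hS
      have h0 := hFV (stmt6EvalMap n (∏ i ∈ S, (1 - MvPolynomial.C 2 * MvPolynomial.X i)))
        ⟨_, (MvPolynomial.mem_restrictTotalDegree _ _ _).2
          ((stmt6_aux_charpoly n S).trans hS), rfl⟩
      rw [hF, neg_eq_zero] at h0
      unfold boolFourierCoeff
      rw [mul_eq_zero]
      right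
      rw [← h0]
      apply Finset.sum_congr rfl
      intro x _
      rw [stmt6EvalMap_apply, map_prod]
      congr 1
      apply Finset.prod_congr rfl
      intro i _
      rcases hxi : x i <;> norm_num [hxi]
    · let g : (Fin n → Bool) → ℝ := fun x =>
        if x ∈ D then f x - ε * SignType.sign (ψ x) else -(1 + ε) * SignType.sign (ψ x)
      have hs : ∀ t : ℝ, -1 ≤ ((SignType.sign t : SignType) : ℝ) ∧
          ((SignType.sign t : SignType) : ℝ) ≤ 1 := by
        intro t
        rcases lt_trichotomy t 0 with h | h | h <;> simp [h]
      have hg : g ∈ Set.Icc a b := by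
        constructor <;> intro x <;> by_cases hx : x ∈ D <;> simp only [a, b, g, hx, if_true, if_false]
          <;> nlinarith [hs (ψ x)]
      have h1 := (hFu g hg).trans (huv.trans hv)
      rw [hF] at h1
      rw [← Finset.sum_add_sum_compl D] at h1
      rw [← Finset.sum_add_sum_compl D (fun x => |ψ x|)]
      have e1 : ∑ x ∈ D, ψ x * g x = ∑ x ∈ D, f x * ψ x - ε * ∑ x ∈ D, |ψ x| := by
        rw [Finset.mul_sum, ← Finset.sum_sub_distrib]
        apply Finset.sum_congr rfl
        intro x hx
        simp only [g, hx, if_true]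
        rw [← sign_mul_self (ψ x)]; ring
      have e2 : ∑ x ∈ Dᶜ, ψ x * g x = -(1 + ε) * ∑ x ∈ Dᶜ, |ψ x| := by
        rw [Finset.mul_sum]
        apply Finset.sum_congr rfl
        intro x hx
        have hx' : x ∉ D := by simpa using hx
        simp only [g, hx', if_false]
        rw [← sign_mul_self (ψ x)]; ring
      rw [e1, e2] at h1
      linarith
  · rintro ⟨ψ, hψ, hpos⟩ ⟨π, hdeg, hD, hDc⟩
    have h0 := stmt6_aux_orth n d ψ hψ π hdeg
    set p : (Fin n → Bool) → ℝ :=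
      fun x => MvPolynomial.eval (fun i => if x i then (1 : ℝ) else 0) π with hp
    rw [← Finset.sum_add_sum_compl D] at h0
    rw [← Finset.sum_add_sum_compl D (fun x => |ψ x|)] at hpos
    have b1 : ∑ x ∈ D, f x * ψ x - ∑ x ∈ D, ψ x * p x ≤ ε * ∑ x ∈ D, |ψ x| := by
      rw [Finset.mul_sum, ← Finset.sum_sub_distrib]
      apply Finset.sum_le_sum
      intro x hx
      calc f x * ψ x - ψ x * p x = (f x - p x) * ψ x := by ring
        _ ≤ |(f x - p x) * ψ x| := le_abs_self _
        _ = |f x - p x| * |ψ x| := abs_mul _ _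
        _ ≤ _ := mul_le_mul_of_nonneg_right (hD x hx) (abs_nonneg _)
    have b2 : - ∑ x ∈ Dᶜ, ψ x * p x ≤ (1 + ε) * ∑ x ∈ Dᶜ, |ψ x| := by
      rw [Finset.mul_sum, ← Finset.sum_neg_distrib]
      apply Finset.sum_le_sum
      intro x hx
      calc -(ψ x * p x) ≤ |ψ x * p x| := neg_le_abs _
        _ = |p x| * |ψ x| := by rw [abs_mul, mul_comm]
        _ ≤ _ := mul_le_mul_of_nonneg_right (hDc x (by simpa using hx)) (abs_nonneg _)
    simp only [hp] at b1 b2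
    linarith
end
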